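/- Let K ≥ 1, n ≥ 1, c ≥ 1 be natural numbers and set m = n·c. For each critical state k ∈ Fin K and each environment i ∈ Fin n, let p̄_{k,i} ∈ [0,1] be a real number, and assume p̄_{k,i} ≤ p̄_{k,n} for all k and i, where index n denotes the final environment. Define, for each k, the MSVIPER coverage probability q_k = 1 − ∏_{i=1}^{n} p̄_{k,i}^c and the VIPER coverage probability p_k = 1 − p̄_{k,n}^m. Let μ_p and μ_q be the product measures on Fin K → Bool whose k-th factors are Bernoulli with success probabilities p_k and q_k respectively. Then for every real ε with 0 < ε < 1, μ_q { x : (number of k with x k = true) ≥ ε·K } ≥ μ_p { x : (number of k with x k = true) ≥ ε·K }. (This is the paper's sample-complexity theorem P_M(ε | S_C, l, m, E) ≥ P_V(ε | S_C, l, m): under an equal total budget of m trajectories, the probability that MSVIPER's training data contains at least an ε-fraction of the K critical states is at least the corresponding probability for single-scenario VIPER, provided no environment misses any critical state more often than the final environment does.) -/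

import Mathlib

open MeasureTheory

/-- The Bernoulli measure on `Bool` assigning probability `r` to `true`
and `1 - r` to `false`. -/
noncomputable def bernoulliMeasure (r : ℝ) : Measure Bool :=
  (ENNReal.ofReal r) • Measure.dirac true +
    (ENNReal.ofReal (1 - r)) • Measure.dirac false

theorem measurable_decide_le (r : ℝ) : Measurable (fun u : ℝ => decide (u ≤ r)) := by
  refine measurable_to_bool ?_
  convert measurableSet_Iic (a := r) using 1
  ext u
  simp

theorem bernoulliMeasure_eq_map_restrict_volume {r : ℝ} (h0 : 0 ≤ r) (h1 : r ≤ 1) :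
    bernoulliMeasure r =
      ((volume : Measure ℝ).restrict (Set.Icc 0 1)).map (fun u => decide (u ≤ r)) := by
  have htrue : (fun u : ℝ => decide (u ≤ r)) ⁻¹' {true} ∩ Set.Icc 0 1 = Set.Icc 0 r := by
    ext u
    simp only [Set.mem_inter_iff, Set.mem_preimage, Set.mem_singleton_iff, decide_eq_true_eq,
      Set.mem_Icc]
    constructor
    · rintro ⟨h, h', -⟩
      exact ⟨h', h⟩
    · rintro ⟨h, h'⟩
      exact ⟨h', h, h'.trans h1⟩
  have hfalse : (fun u : ℝ => decide (u ≤ r)) ⁻¹' {false} ∩ Set.Icc 0 1 = Set.Ioc r 1 := by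
    ext u
    simp only [Set.mem_inter_iff, Set.mem_preimage, Set.mem_singleton_iff, decide_eq_false_iff_not,
      not_le, Set.mem_Icc, Set.mem_Ioc]
    constructor
    · rintro ⟨h, -, h'⟩
      exact ⟨h, h'⟩
    · rintro ⟨h, h'⟩
      exact ⟨h, h0.trans h.le, h'⟩
  refine Measure.ext_of_singleton fun b => ?_
  rw [Measure.map_apply (measurable_decide_le r) (measurableSet_singleton b),
    Measure.restrict_apply (measurable_decide_le r (measurableSet_singleton b))]
  cases b
  · rw [hfalse]
    simp [bernoulliMeasure]
  · rw [htrue]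
    simp [bernoulliMeasure]

/-- Product Bernoulli measures are stochastically monotone in their success probabilities. -/
theorem pi_bernoulliMeasure_mono {ι : Type*} [Fintype ι] {p q : ι → ℝ}
    (hp : ∀ k, 0 ≤ p k) (hpq : ∀ k, p k ≤ q k) (hq : ∀ k, q k ≤ 1)
    {S : Set (ι → Bool)} (hS : IsUpperSet S) :
    Measure.pi (fun k => bernoulliMeasure (p k)) S ≤
      Measure.pi (fun k => bernoulliMeasure (q k)) S := by
  have hpi {r : ι → ℝ} (h0 : ∀ k, 0 ≤ r k) (h1 : ∀ k, r k ≤ 1) :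
      Measure.pi (fun k => bernoulliMeasure (r k)) S =
        Measure.pi (fun _ : ι => (volume : Measure ℝ).restrict (Set.Icc 0 1))
          ((fun u k => decide (u k ≤ r k)) ⁻¹' S) := by
    simp_rw [fun k => bernoulliMeasure_eq_map_restrict_volume (h0 k) (h1 k)]
    rw [← Measure.pi_map_pi fun k => (measurable_decide_le (r k)).aemeasurable]
    exact Measure.map_apply
      (measurable_pi_lambda _ fun k => (measurable_decide_le (r k)).comp (measurable_pi_apply k))
      S.toFinite.measurableSet
  rw [hpi hp fun k => (hpq k).trans (hq k), hpi (fun k => (hp k).trans (hpq k)) hq]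
  refine measure_mono fun u hu => hS (fun k => ?_) hu
  rw [Bool.le_iff_imp]
  simpa using fun h => h.trans (hpq k)

/-- MSVIPER sample-complexity theorem `P_M(ε|S_C,l,m,E) ≥ P_V(ε|S_C,l,m)`:
with an equal budget `m = n·c` of trajectories, if no environment misses any
critical state more often than the final environment (`p̄ k i ≤ p̄ k (n-1)`),
then for every `0 < ε < 1` the probability that at least an `ε`-fraction of the
`K` critical states is covered is at least as large under MSVIPER's coverage
probabilities `q k = 1 - ∏ i, (p̄ k i)^c` as under VIPER's
`p k = 1 - (p̄ k (n-1))^m`. -/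
theorem msviper_sample_complexity (K n c m : ℕ)
    (hK : 1 ≤ K) (hn : 1 ≤ n) (hc : 1 ≤ c) (hm : m = n * c)
    (pbar : Fin K → Fin n → ℝ)
    (hpbar0 : ∀ k i, 0 ≤ pbar k i) (hpbar1 : ∀ k i, pbar k i ≤ 1)
    (hle : ∀ k i, pbar k i ≤ pbar k ⟨n - 1, Nat.sub_lt hn one_pos⟩)
    (p q : Fin K → ℝ)
    (hq : ∀ k, q k = 1 - ∏ i, (pbar k i) ^ c)
    (hp : ∀ k, p k = 1 - (pbar k ⟨n - 1, Nat.sub_lt hn one_pos⟩) ^ m)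
    (ε : ℝ) (hε0 : 0 < ε) (hε1 : ε < 1) :
    Measure.pi (fun k => bernoulliMeasure (q k))
        {x : Fin K → Bool |
          ε * K ≤ ((Finset.univ.filter fun k => x k = true).card : ℝ)} ≥
      Measure.pi (fun k => bernoulliMeasure (p k))
        {x : Fin K → Bool |
          ε * K ≤ ((Finset.univ.filter fun k => x k = true).card : ℝ)} := by
  refine pi_bernoulliMeasure_mono (fun k => ?_) (fun k => ?_) (fun k => ?_) ?_
  · rw [hp, sub_nonneg]
    exact pow_le_one₀ (hpbar0 k _) (hpbar1 k _)
  · rw [hp, hq, hm]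
    refine sub_le_sub_left ?_ 1
    calc ∏ i, pbar k i ^ c
        ≤ ∏ _i : Fin n, pbar k ⟨n - 1, Nat.sub_lt hn one_pos⟩ ^ c :=
          Finset.prod_le_prod (fun i _ => pow_nonneg (hpbar0 k i) c)
            fun i _ => pow_le_pow_left₀ (hpbar0 k i) (hle k i) c
      _ = pbar k ⟨n - 1, Nat.sub_lt hn one_pos⟩ ^ (n * c) := by
          rw [Finset.prod_const, Finset.card_univ, Fintype.card_fin, ← pow_mul, mul_comm]
  · rw [hq, sub_le_self_iff]
    exact Finset.prod_nonneg fun i _ => pow_nonneg (hpbar0 k i) c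
  · intro x y hxy hx
    refine le_trans (Set.mem_ofPred_eq ▸ hx) (Nat.cast_le.mpr (Finset.card_le_card fun k hk => ?_))
    simp only [Finset.mem_filter, Finset.mem_univ, true_and] at hk ⊢
    exact Bool.le_iff_imp.mp (hxy k) hk
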